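/- Let M be a ℂ-vector space, let α, β ∈ M, and let ℓ ≥ 2. Let S_ℓ be the set of tuples t = (t_1,…,t_{ℓ−1}) ∈ {0,1,2}^{ℓ−1} such that for all 1 ≤ i ≤ ℓ−2: if t_i ∈ {0,2} then t_{i+1} ∈ {1,2}, and if t_i = 1 then t_{i+1} = 0. Set v(0) = α, v(1) = β, v(2) = α+β, and sgn(t) = (−1)^{ℓ−1−k(t)−e(t)}, where k(t) = #{ i : t_i = 0 } and e(t) = 1 if t_{ℓ−1} = 1 while e(t) = 0 otherwise. Then Σ_{t ∈ S_ℓ} sgn(t)·v(t_1)⊗v(t_2)⊗⋯⊗v(t_{ℓ−1}) = 0 in the (ℓ−1)-fold tensor power M^{⊗(ℓ−1)} over ℂ. -/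

import Mathlib

open scoped TensorProduct

def AdmT {n : ℕ} (t : Fin n → Fin 3) : Prop :=
  ∀ i j : Fin n, (j : ℕ) = (i : ℕ) + 1 →
    ((t i = 0 ∨ t i = 2) → (t j = 1 ∨ t j = 2)) ∧ (t i = 1 → t j = 0)

theorem admT_cons {n : ℕ} (a : Fin 3) (t : Fin (n + 1) → Fin 3) :
    AdmT (Fin.cons a t : Fin (n + 2) → Fin 3) ↔
      (((a = 0 ∨ a = 2) → (t 0 = 1 ∨ t 0 = 2)) ∧ (a = 1 → t 0 = 0)) ∧ AdmT t := by
  constructor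
  · intro h
    refine ⟨by simpa using h 0 (Fin.succ 0) (by simp), ?_⟩
    intro i j hij
    simpa using h i.succ j.succ (by simp [hij])
  · rintro ⟨h1, h2⟩ i j hij
    induction j using Fin.cases with
    | zero => simp at hij
    | succ j =>
      induction i using Fin.cases with
      | zero =>
        have : j = 0 := by
          apply Fin.ext
          simpa using hij
        subst this
        simpa using h1
      | succ i =>
        simpa using h2 i j (by simpa using hij)

/-- The exponent of the sign. -/
def expT {n : ℕ} (t : Fin (n + 1) → Fin 3) : ℕ :=
  n + 1 - (Finset.univ.filter fun i => t i = 0).card - (if t (Fin.last n) = 1 then 1 else 0)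

theorem card_le_T {n : ℕ} (t : Fin (n + 1) → Fin 3) :
    (Finset.univ.filter fun i => t i = 0).card + (if t (Fin.last n) = 1 then 1 else 0)
      ≤ n + 1 := by
  split_ifs with h
  · have : (Finset.univ.filter fun i => t i = 0).card < (Finset.univ : Finset (Fin (n + 1))).card := by
      apply Finset.card_lt_card
      rw [Finset.filter_ssubset]
      exact ⟨Fin.last n, by simp, by simp [h]⟩
    simp only [Finset.card_univ, Fintype.card_fin] at this
    omega
  · simpa using Finset.card_le_univ (Finset.univ.filter fun i => t i = 0)

theorem card_cons_T {n : ℕ} (a : Fin 3) (t : Fin n → Fin 3) :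
    (Finset.univ.filter fun i => (Fin.cons a t : Fin (n + 1) → Fin 3) i = 0).card =
      (if a = 0 then 1 else 0) + (Finset.univ.filter fun i => t i = 0).card := by
  simp only [Finset.card_filter, Fin.sum_univ_succ, Fin.cons_zero, Fin.cons_succ]

theorem expT_cons {n : ℕ} (a : Fin 3) (t : Fin (n + 1) → Fin 3) :
    expT (Fin.cons a t : Fin (n + 2) → Fin 3) = if a = 0 then expT t else expT t + 1 := by
  have h := card_le_T t
  have h2 : (Fin.cons a t : Fin (n + 2) → Fin 3) (Fin.last (n + 1)) = t (Fin.last n) := by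
    rw [← Fin.succ_last, Fin.cons_succ]
  unfold expT
  rw [card_cons_T, h2]
  by_cases ha : a = 0
  · simp only [ha, if_true]; omega
  · simp only [ha, if_false]; omega

open Classical in
theorem sum_multilinear_T {M N : Type} [AddCommGroup M] [Module ℂ M] [AddCommGroup N] [Module ℂ N]
    (α β : M) (n : ℕ) (f : MultilinearMap ℂ (fun _ : Fin (n + 1) => M) N) :
    ∑ t : Fin (n + 1) → Fin 3, (if AdmT t then
      ((-1 : ℂ) ^ expT t • f (fun i => ![α, β, α + β] (t i))) else 0) = 0 := by
  induction n with
  | zero =>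
    have hA : ∀ t : Fin 1 → Fin 3, AdmT t := by
      intro t i j hij
      omega
    have hf : ∀ x : M, f (fun _ => x) = f.curryLeft x Fin.elim0 := by
      intro x
      rw [MultilinearMap.curryLeft_apply]
      congr 1
      ext i
      fin_cases i
      rfl
    rw [← (Equiv.funUnique (Fin 1) (Fin 3)).symm.sum_comp]
    simp only [hA, if_true, Fin.sum_univ_three]
    simp [expT, hf]
    abel
  | succ n ih =>
    rw [← (Fin.consEquiv (fun _ : Fin (n + 2) => Fin 3)).sum_comp, Fintype.sum_prod_type_right]
    have key := ih (f.curryLeft β)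
    rw [← neg_eq_zero, ← Finset.sum_neg_distrib] at key
    refine Eq.trans ?_ key
    refine Finset.sum_congr rfl fun t _ => ?_
    have hf : ∀ a : Fin 3, f (fun i => ![α, β, α + β] ((Fin.cons a t : Fin (n + 2) → Fin 3) i)) =
        f.curryLeft (![α, β, α + β] a) (fun i => ![α, β, α + β] (t i)) := by
      intro a
      rw [MultilinearMap.curryLeft_apply]
      congr 1
      ext i
      induction i using Fin.cases <;> simp
    have hc : ∀ a : Fin 3, (Fin.consEquiv (fun _ : Fin (n + 2) => Fin 3)) (a, t) =
      (Fin.cons a t : Fin (n + 2) → Fin 3) := fun _ => rfl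
    simp only [hc, hf, admT_cons, expT_cons, Fin.sum_univ_three]
    by_cases hA : AdmT t
    · have h3 : t 0 = 0 ∨ t 0 = 1 ∨ t 0 = 2 := by
        generalize t 0 = x
        fin_cases x <;> simp
      rcases h3 with h | h | h <;> simp [hA, h, pow_succ] <;> abel
    · simp [hA]

/-- **The sign-reversing cancellation of Theorem 5.3(b).**
Let `M` be a `ℂ`-vector space, `α, β ∈ M`, `ℓ ≥ 2`.  Summing over all tuples
`t ∈ {α, β, α+β}^{ℓ-1}` (encoded by `t : Fin (ℓ-1) → Fin 3` via `0 ↦ α`, `1 ↦ β`,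
`2 ↦ α+β`) such that each entry `α` or `α+β` is followed by `β` or `α+β` and each entry
`β` is followed by `α`, the signed pure tensors `sgn(t)·v(t₁)⊗⋯⊗v(t_{ℓ-1})` with
`sgn(t) = (−1)^{ℓ−1−#{i : tᵢ = α} − [t_{ℓ-1} = β]}` add up to `0` in `M^{⊗(ℓ-1)}`. -/
theorem signed_sum_of_admissible_tuples_vanishes
    (M : Type) [AddCommGroup M] [Module ℂ M] (α β : M) (ℓ : ℕ) (hℓ : 2 ≤ ℓ) :
    ∑ t : Fin (ℓ - 1) → Fin 3,
      (if (∀ i j : Fin (ℓ - 1), (j : ℕ) = (i : ℕ) + 1 →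
            ((t i = 0 ∨ t i = 2) → (t j = 1 ∨ t j = 2)) ∧ (t i = 1 → t j = 0))
        then
          ((-1 : ℂ) ^ (ℓ - 1 - (Finset.univ.filter fun i => t i = 0).card -
                (if t ⟨ℓ - 2, by omega⟩ = 1 then 1 else 0)) •
            PiTensorProduct.tprod ℂ (fun i : Fin (ℓ - 1) => ![α, β, α + β] (t i)))
        else 0) = 0 := by
  obtain ⟨m, rfl⟩ : ∃ m, ℓ = m + 2 := ⟨ℓ - 2, by omega⟩
  have h := sum_multilinear_T α β m (PiTensorProduct.tprod ℂ)
  refine Eq.trans ?_ h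
  refine Finset.sum_congr rfl fun t _ => ?_
  by_cases hA : AdmT t
  · rw [if_pos hA]
    exact if_pos hA
  · rw [if_neg hA]
    exact if_neg hA
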